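/- Let n ∈ ℕ and let q, a, b, d, e be nonzero complex numbers such that q^j ≠ 1 for 1 ≤ j ≤ n, d ≠ q^{−j} and e ≠ q^{−j} for 0 ≤ j ≤ n−1, and e ≠ a·q^{1−n+j} for 0 ≤ j ≤ n−1. Then the two terminating basic hypergeometric sums are related by: Σ_{k=0}^{n} [ (q^n;q^{−1})_k·(a^{−1};q^{−1})_k·(b^{−1};q^{−1})_k / ( (q^{−1};q^{−1})_k·(d^{−1};q^{−1})_k·(e^{−1};q^{−1})_k ) ]·q^{−k} = ( (e/a;q)_n / (e;q)_n ) · Σ_{k=0}^{n} [ (q^{−n};q)_k·(a;q)_k·(d/b;q)_k / ( (q;q)_k·(d;q)_k·(a·q^{1−n}/e;q)_k ) ]·q^{k}. In basic hypergeometric notation this reads ₃φ₂(qⁿ, 1/a, 1/b; 1/d, 1/e; q^{−1}, q^{−1}) = ((e/a;q)_n/(e;q)_n) · ₃φ₂(q^{−n}, a, d/b; d, aq^{1−n}/e; q, q). -/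

import Mathlib

/-- q-Pochhammer symbol `(a;p)_k = ∏_{j=0}^{k-1} (1 - a pʲ)` over ℂ. -/
noncomputable def qPochC (a p : ℂ) (k : ℕ) : ℂ := ∏ j ∈ Finset.range k, (1 - a * p ^ j)

open Finset

lemma qPochC_succ (a p : ℂ) (k : ℕ) : qPochC a p (k + 1) = qPochC a p k * (1 - a * p ^ k) :=
  prod_range_succ _ _

lemma qPochC_add (a p : ℂ) (j m : ℕ) :
    qPochC a p (j + m) = qPochC a p j * qPochC (a * p ^ j) p m := by
  simp only [qPochC, prod_range_add, pow_add, mul_assoc]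

lemma qPochC_succ' (a p : ℂ) (k : ℕ) : qPochC a p (k + 1) = (1 - a) * qPochC (a * p) p k := by
  rw [add_comm, qPochC_add]
  simp [qPochC]

lemma qPochC_ne_zero {a p : ℂ} {k : ℕ} (h : ∀ j < k, a * p ^ j ≠ 1) : qPochC a p k ≠ 0 :=
  prod_ne_zero_iff.2 fun j hj => sub_ne_zero.2 (h j (mem_range.1 hj)).symm

/-- Base inversion for the q-Pochhammer symbol. -/
lemma qPochC_inv {c q : ℂ} (hc : c ≠ 0) (hq : q ≠ 0) (k : ℕ) :
    qPochC c⁻¹ q⁻¹ k = qPochC c q k * c⁻¹ ^ k * ∏ j ∈ range k, (-(q ^ j)⁻¹) := by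
  rw [← card_range k, ← prod_const, card_range, qPochC, qPochC, ← prod_mul_distrib,
    ← prod_mul_distrib]
  refine prod_congr rfl fun j _ => ?_
  rw [inv_pow]
  field_simp
  ring

/-- Reversal of the order of the factors of a q-Pochhammer symbol. -/
lemma qPochC_reverse {c u q : ℂ} (hq : q ≠ 0) (j : ℕ) (h : c * u * q ^ j = q) :
    qPochC c q j = (-c) ^ j * (∏ i ∈ range j, q ^ i) * qPochC u q j := by
  have hu : qPochC u q j = ∏ i ∈ range j, (1 - u * q ^ (j - 1 - i)) :=
    (prod_range_reflect (fun i => 1 - u * q ^ i) j).symm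
  rw [hu, ← card_range j, ← prod_const, card_range, qPochC, ← prod_mul_distrib,
    ← prod_mul_distrib]
  refine prod_congr rfl fun i hi => ?_
  have hi := mem_range.1 hi
  have hpow : q ^ j = q ^ i * q ^ (j - 1 - i) * q := by
    rw [← pow_add, ← pow_succ]; congr 1; omega
  have h1 : c * u * (q ^ i * q ^ (j - 1 - i)) = 1 := by
    apply mul_right_cancel₀ hq
    rw [one_mul, mul_assoc, ← hpow, h]
  linear_combination -h1

lemma prod_range_pow_sq (q : ℂ) (j : ℕ) :
    q ^ j * (∏ i ∈ range j, q ^ i) ^ 2 = (q ^ j) ^ j := by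
  induction j with
  | zero => simp
  | succ j ih =>
    rw [prod_range_succ]
    have : (q ^ (j + 1)) ^ (j + 1) = (q ^ j) ^ j * (q ^ j) ^ 2 * q := by ring
    rw [this, ← ih]
    ring

/-- The weight `(q⁻ᵏ;q)_j qʲ / (q;q)_j` of a terminating basic hypergeometric sum. -/
noncomputable def qWeight (q : ℂ) (k j : ℕ) : ℂ :=
  qPochC (q ^ k)⁻¹ q j / qPochC q q j * q ^ j

lemma qWeight_zero_right (q : ℂ) (k : ℕ) : qWeight q k 0 = 1 := by simp [qWeight, qPochC]

lemma qWeight_succ_self {q : ℂ} (hq : q ≠ 0) (k : ℕ) : qWeight q k (k + 1) = 0 := by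
  simp [qWeight, qPochC_succ, inv_mul_cancel₀ (pow_ne_zero k hq)]

lemma qPochC_self_ne_zero {q : ℂ} {k : ℕ} (h : ∀ j : ℕ, 1 ≤ j → j ≤ k → q ^ j ≠ 1) :
    qPochC q q k ≠ 0 :=
  qPochC_ne_zero fun j hj => by
    rw [← pow_succ']
    exact h (j + 1) (by omega) (by omega)

lemma qWeight_succ_succ {q : ℂ} (hq : q ≠ 0) {k j : ℕ} (hjk : j ≤ k)
    (h : ∀ i : ℕ, 1 ≤ i → i ≤ k + 1 → q ^ i ≠ 1) :
    qWeight q (k + 1) (j + 1) = qWeight q k (j + 1) - (q ^ k)⁻¹ * qWeight q k j := by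
  have h1 : qPochC q q j ≠ 0 := qPochC_self_ne_zero fun i hi hij => h i hi (by omega)
  have h2 : 1 - q * q ^ j ≠ 0 := by
    rw [← pow_succ', sub_ne_zero]; exact (h (j + 1) (by omega) (by omega)).symm
  have h3 : (q ^ (k + 1))⁻¹ * q = (q ^ k)⁻¹ := by rw [pow_succ]; field_simp
  simp only [qWeight]
  rw [qPochC_succ', h3, qPochC_succ, qPochC_succ]
  field_simp
  ring

lemma qWeight_succ_succ' {q : ℂ} (hq : q ≠ 0) {k j : ℕ} (hjk : j ≤ k)
    (h : ∀ i : ℕ, 1 ≤ i → i ≤ k + 1 → q ^ i ≠ 1) :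
    qWeight q (k + 1) (j + 1) =
      qWeight q k (j + 1) * (q ^ (j + 1))⁻¹ - qWeight q k j * (q ^ j)⁻¹ := by
  have h1 : qPochC q q j ≠ 0 := qPochC_self_ne_zero fun i hi hij => h i hi (by omega)
  have h2 : 1 - q * q ^ j ≠ 0 := by
    rw [← pow_succ', sub_ne_zero]; exact (h (j + 1) (by omega) (by omega)).symm
  have h3 : (q ^ (k + 1))⁻¹ * q = (q ^ k)⁻¹ := by rw [pow_succ]; field_simp
  simp only [qWeight]
  rw [qPochC_succ', h3, qPochC_succ, qPochC_succ]
  field_simp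
  ring

lemma sum_qWeight_succ {q : ℂ} (hq : q ≠ 0) {k : ℕ}
    (h : ∀ i : ℕ, 1 ≤ i → i ≤ k + 1 → q ^ i ≠ 1) (f : ℕ → ℂ) :
    ∑ j ∈ range (k + 2), qWeight q (k + 1) j * f j =
      ∑ j ∈ range (k + 1), qWeight q k j * (f j - (q ^ k)⁻¹ * f (j + 1)) := by
  have h1 : ∑ j ∈ range (k + 1), qWeight q k j * f j =
      ∑ j ∈ range (k + 1), qWeight q k (j + 1) * f (j + 1) + f 0 := by
    have := sum_range_succ' (fun j => qWeight q k j * f j) (k + 1)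
    rw [sum_range_succ, qWeight_succ_self hq, qWeight_zero_right] at this
    simpa using this
  rw [sum_range_succ', qWeight_zero_right, one_mul]
  simp only [mul_sub, sum_sub_distrib]
  rw [h1, add_sub_right_comm, ← sum_sub_distrib]
  congr 1
  refine sum_congr rfl fun j hj => ?_
  rw [qWeight_succ_succ hq (Nat.lt_succ_iff.1 (mem_range.1 hj)) h]
  ring

lemma sum_qWeight_succ' {q : ℂ} (hq : q ≠ 0) {k : ℕ}
    (h : ∀ i : ℕ, 1 ≤ i → i ≤ k + 1 → q ^ i ≠ 1) (f : ℕ → ℂ) :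
    ∑ j ∈ range (k + 2), qWeight q (k + 1) j * f j =
      ∑ j ∈ range (k + 1), qWeight q k j * ((q ^ j)⁻¹ * (f j - f (j + 1))) := by
  have h1 : ∑ j ∈ range (k + 1), qWeight q k j * ((q ^ j)⁻¹ * f j) =
      ∑ j ∈ range (k + 1), qWeight q k (j + 1) * ((q ^ (j + 1))⁻¹ * f (j + 1)) + f 0 := by
    have := sum_range_succ' (fun j => qWeight q k j * ((q ^ j)⁻¹ * f j)) (k + 1)
    rw [sum_range_succ, qWeight_succ_self hq, qWeight_zero_right] at this
    simpa using this
  rw [sum_range_succ', qWeight_zero_right, one_mul]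
  simp only [mul_sub, sum_sub_distrib]
  rw [h1, add_sub_right_comm, ← sum_sub_distrib]
  congr 1
  refine sum_congr rfl fun j hj => ?_
  rw [qWeight_succ_succ' hq (Nat.lt_succ_iff.1 (mem_range.1 hj)) h]
  ring

/-- The q-Chu–Vandermonde sum with argument `q`. -/
lemma sum_qWeight_mul_div {q : ℂ} (hq : q ≠ 0) {B : ℂ} (hB : B ≠ 0) (k : ℕ)
    (h : ∀ i : ℕ, 1 ≤ i → i ≤ k → q ^ i ≠ 1) (C : ℂ) (hC : ∀ i < k, C * q ^ i ≠ 1) :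
    ∑ j ∈ range (k + 1), qWeight q k j * (qPochC B q j / qPochC C q j) =
      qPochC (C / B) q k / qPochC C q k * B ^ k := by
  induction k generalizing C with
  | zero => simp [qWeight, qPochC]
  | succ k ih =>
    have hC0 : 1 - C ≠ 0 := sub_ne_zero.2 (by simpa using (hC 0 (by omega)).symm)
    have hC' : ∀ i < k, C * q * q ^ i ≠ 1 := fun i hi => by
      rw [mul_assoc, ← pow_succ']; exact hC (i + 1) (by omega)
    rw [sum_qWeight_succ' hq h, qPochC_succ', qPochC_succ' C, div_mul_eq_mul_div C B q]
    have key : ∀ j ∈ range (k + 1), qWeight q k j * ((q ^ j)⁻¹ *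
        (qPochC B q j / qPochC C q j - qPochC B q (j + 1) / qPochC C q (j + 1))) =
        (B - C) / (1 - C) * (qWeight q k j * (qPochC B q j / qPochC (C * q) q j)) := by
      intro j hj
      have hj := mem_range.1 hj
      have e1 : qPochC C q j ≠ 0 := qPochC_ne_zero fun i hi => hC i (by omega)
      have e2 : 1 - C * q ^ j ≠ 0 := sub_ne_zero.2 (hC j (by omega)).symm
      have e3 : qPochC (C * q) q j ≠ 0 := qPochC_ne_zero fun i hi => hC' i (by omega)
      have e4 : (1 - C) * qPochC (C * q) q j = qPochC C q j * (1 - C * q ^ j) := by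
        rw [← qPochC_succ', qPochC_succ]
      have e5 : qPochC B q j / qPochC C q j - qPochC B q (j + 1) / qPochC C q (j + 1) =
          q ^ j * (B - C) * qPochC B q j / (qPochC C q j * (1 - C * q ^ j)) := by
        rw [qPochC_succ, qPochC_succ]
        obtain ⟨D, hD⟩ : ∃ D, D = 1 - C * q ^ j := ⟨_, rfl⟩
        rw [← hD] at e2 ⊢
        field_simp
        rw [hD]
        ring
      rw [e5, ← e4]
      field_simp
    rw [sum_congr rfl key, ← mul_sum, ih (fun i hi hik => h i hi (by omega)) _ hC']
    have e6 : qPochC (C * q) q k ≠ 0 := qPochC_ne_zero hC'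
    field_simp
    ring

/-- The q-Chu–Vandermonde sum with argument `C q^N / A`. -/
lemma sum_qWeight_mul_div_mul_pow {q : ℂ} (hq : q ≠ 0) {A : ℂ} (hA : A ≠ 0) (N : ℕ)
    (h : ∀ i : ℕ, 1 ≤ i → i ≤ N → q ^ i ≠ 1) (C : ℂ) (hC : ∀ i < N, C * q ^ i ≠ 1) :
    ∑ m ∈ range (N + 1),
        qWeight q N m * (qPochC A q m / qPochC C q m * (C * q ^ N / (A * q)) ^ m) =
      qPochC (C / A) q N / qPochC C q N := by
  induction N generalizing C with
  | zero => simp [qWeight, qPochC]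
  | succ k ih =>
    have hC0 : 1 - C ≠ 0 := sub_ne_zero.2 (by simpa using (hC 0 (by omega)).symm)
    have hC' : ∀ i < k, C * q * q ^ i ≠ 1 := fun i hi => by
      rw [mul_assoc, ← pow_succ']; exact hC (i + 1) (by omega)
    rw [sum_qWeight_succ hq h, qPochC_succ', qPochC_succ' C, div_mul_eq_mul_div C A q]
    have hx : C * q ^ (k + 1) / (A * q) = C * q * q ^ k / (A * q) := by ring
    have key : ∀ m ∈ range (k + 1), qWeight q k m *
        (qPochC A q m / qPochC C q m * (C * q ^ (k + 1) / (A * q)) ^ m - (q ^ k)⁻¹ *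
          (qPochC A q (m + 1) / qPochC C q (m + 1) * (C * q ^ (k + 1) / (A * q)) ^ (m + 1))) =
        (1 - C / A) / (1 - C) * (qWeight q k m *
          (qPochC A q m / qPochC (C * q) q m * (C * q * q ^ k / (A * q)) ^ m)) := by
      intro m hm
      have hm := mem_range.1 hm
      have e1 : qPochC C q m ≠ 0 := qPochC_ne_zero fun i hi => hC i (by omega)
      have e2 : 1 - C * q ^ m ≠ 0 := sub_ne_zero.2 (hC m (by omega)).symm
      have e3 : qPochC (C * q) q m ≠ 0 := qPochC_ne_zero fun i hi => hC' i (by omega)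
      have e4 : (1 - C) * qPochC (C * q) q m = qPochC C q m * (1 - C * q ^ m) := by
        rw [← qPochC_succ', qPochC_succ]
      have e5 : ∀ y : ℂ, qPochC A q m / qPochC C q m * y - (q ^ k)⁻¹ *
          (qPochC A q (m + 1) / qPochC C q (m + 1) * (y * (C * q * q ^ k / (A * q)))) =
          (1 - C / A) * qPochC A q m * y / (qPochC C q m * (1 - C * q ^ m)) := by
        intro y
        rw [qPochC_succ, qPochC_succ]
        obtain ⟨D, hD⟩ : ∃ D, D = 1 - C * q ^ m := ⟨_, rfl⟩
        rw [← hD] at e2 ⊢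
        field_simp
        rw [hD]
        ring
      rw [hx, pow_succ, e5, ← e4]
      field_simp
    rw [sum_congr rfl key, ← mul_sum, ih (fun i hi hik => h i hi (by omega)) _ hC']
    have e6 : qPochC (C * q) q k ≠ 0 := qPochC_ne_zero hC'
    field_simp

lemma qWeight_mul_qWeight {q : ℂ} (hq : q ≠ 0) (j N m : ℕ) (hm : m ≤ N)
    (h : ∀ i : ℕ, 1 ≤ i → i ≤ j + N → q ^ i ≠ 1) :
    qWeight q (j + N) (j + m) * qWeight q (j + m) j =
      qWeight q (j + N) j * qWeight q N m *
        (q ^ j * ((-(q ^ (j + m))⁻¹) ^ j * ∏ i ∈ range j, q ^ i)) := by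
  have e1 : qPochC q q j ≠ 0 := qPochC_self_ne_zero fun i hi hij => h i hi (by omega)
  have e2 : qPochC q q m ≠ 0 := qPochC_self_ne_zero fun i hi hij => h i hi (by omega)
  have e3 : qPochC q q (m + j) ≠ 0 := qPochC_self_ne_zero fun i hi hij => h i hi (by omega)
  have e4 : qPochC (q ^ (j + m))⁻¹ q j =
      (-(q ^ (j + m))⁻¹) ^ j * (∏ i ∈ range j, q ^ i) * qPochC (q * q ^ m) q j := by
    apply qPochC_reverse hq
    field_simp
    ring
  have e5 : (q ^ (j + N))⁻¹ * q ^ j = (q ^ N)⁻¹ := by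
    field_simp
    ring
  have e6 := qPochC_add q q m j
  have e7 : qPochC (q * q ^ m) q j ≠ 0 := fun h0 => e3 (by rw [e6, h0, mul_zero])
  simp only [qWeight]
  rw [e4, qPochC_add _ q j m, e5, add_comm j m, e6]
  field_simp
  ring

lemma sum_qWeight_mul_qWeight {q : ℂ} (hq : q ≠ 0) {a e : ℂ} (ha : a ≠ 0) (he : e ≠ 0) (j N : ℕ)
    (h : ∀ i : ℕ, 1 ≤ i → i ≤ j + N → q ^ i ≠ 1) (hE : ∀ i < j + N, e * q ^ i ≠ 1)
    (hc : qPochC (a * q / q ^ (j + N) / e) q j ≠ 0) :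
    ∑ m ∈ range (N + 1), qWeight q (j + N) (j + m) *
        (qPochC a q (j + m) / qPochC e q (j + m) * (e * q ^ (j + N) / (a * q)) ^ (j + m)) *
          qWeight q (j + m) j =
      qPochC (e / a) q (j + N) / qPochC e q (j + N) *
        (qWeight q (j + N) j * (qPochC a q j / qPochC (a * q / q ^ (j + N) / e) q j)) := by
  have hrev : qPochC (a * q / q ^ (j + N) / e) q j =
      (-(a * q / q ^ (j + N) / e)) ^ j * (∏ i ∈ range j, q ^ i) * qPochC (e / a * q ^ N) q j := by
    apply qPochC_reverse hq
    rw [pow_add]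
    field_simp
  set s := ∏ i ∈ range j, q ^ i
  have hs2 : q ^ j * s ^ 2 = (q ^ j) ^ j := prod_range_pow_sq q j
  have hs0 : s ≠ 0 := prod_ne_zero_iff.2 fun i _ => pow_ne_zero i hq
  have hE' : ∀ i < N, e * q ^ j * q ^ i ≠ 1 := fun i hi => by
    rw [mul_assoc, ← pow_add]; exact hE (j + i) (by omega)
  have hCV := sum_qWeight_mul_div_mul_pow hq (mul_ne_zero ha (pow_ne_zero j hq)) N
    (fun i hi hiN => h i hi (by omega)) (e * q ^ j) hE'
  rw [mul_div_mul_right _ _ (pow_ne_zero j hq)] at hCV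
  have key : ∀ m ∈ range (N + 1), qWeight q (j + N) (j + m) *
      (qPochC a q (j + m) / qPochC e q (j + m) * (e * q ^ (j + N) / (a * q)) ^ (j + m)) *
        qWeight q (j + m) j =
      (qWeight q (j + N) j * (qPochC a q j / qPochC e q j) *
        (q ^ j * (e * q ^ (j + N) / (a * q)) ^ j * (-(q ^ j)⁻¹) ^ j * s)) *
      (qWeight q N m * (qPochC (a * q ^ j) q m / qPochC (e * q ^ j) q m *
        (e * q ^ j * q ^ N / (a * q ^ j * q)) ^ m)) := by
    intro m hm
    have h1 := qWeight_mul_qWeight hq j N m (Nat.lt_succ_iff.1 (mem_range.1 hm)) h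
    have h2 : (e * q ^ (j + N) / (a * q)) ^ m * (-(q ^ (j + m))⁻¹) ^ j =
        (e * q ^ j * q ^ N / (a * q ^ j * q)) ^ m * (-(q ^ j)⁻¹) ^ j := by
      have h3 : (-(q ^ (j + m))⁻¹) ^ j = (-(q ^ j)⁻¹) ^ j * ((q ^ j)⁻¹) ^ m := by
        rw [pow_add, mul_inv, ← neg_mul, mul_pow, inv_pow, inv_pow (q ^ j) m, ← pow_mul, ← pow_mul,
          mul_comm m j]
      have h4 : e * q ^ j * q ^ N / (a * q ^ j * q) =
          e * q ^ (j + N) / (a * q) * (q ^ j)⁻¹ := by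
        rw [pow_add]; field_simp
      rw [h3, h4, mul_pow]
      ring
    rw [qPochC_add a, qPochC_add e, pow_add _ j m, mul_right_comm, h1, mul_div_mul_comm]
    linear_combination (qWeight q (j + N) j * qWeight q N m * q ^ j * s *
      (qPochC a q j / qPochC e q j) * (qPochC (a * q ^ j) q m / qPochC (e * q ^ j) q m) *
      (e * q ^ (j + N) / (a * q)) ^ j) * h2
  rw [sum_congr rfl key, ← mul_sum, hCV]
  have h5 : q ^ j * (e * q ^ (j + N) / (a * q)) ^ j * (-(q ^ j)⁻¹) ^ j * s *
      ((-(a * q / q ^ (j + N) / e)) ^ j * s) = 1 := by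
    have h6 : (e * q ^ (j + N) / (a * q)) * (-(q ^ j)⁻¹) * (-(a * q / q ^ (j + N) / e)) =
        (q ^ j)⁻¹ := by
      field_simp
    calc _ = (q ^ j * s ^ 2) * ((e * q ^ (j + N) / (a * q)) * (-(q ^ j)⁻¹) *
          (-(a * q / q ^ (j + N) / e))) ^ j := by rw [mul_pow, mul_pow]; ring
      _ = 1 := by
        rw [h6, hs2, ← mul_pow, mul_inv_cancel₀ (pow_ne_zero j hq), one_pow]
  have hu : qPochC (e / a * q ^ N) q j ≠ 0 := fun h0 => hc (by rw [hrev, h0, mul_zero])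
  have hK := eq_inv_of_mul_eq_one_left h5
  rw [hK, hrev, qPochC_add e, add_comm j N, qPochC_add (e / a)]
  generalize qPochC (e / a * q ^ N) q j = U at hu
  field_simp

/-- The ₃φ₂ transformation
`₃φ₂(qⁿ, 1/a, 1/b; 1/d, 1/e; q⁻¹, q⁻¹) = ((e/a;q)_n/(e;q)_n) ₃φ₂(q⁻ⁿ, a, d/b; d, aq^{1-n}/e; q, q)`,
written out as an identity of terminating sums. -/
theorem phi32_transformation
    (n : ℕ) (q a b d e : ℂ)
    (hq : q ≠ 0) (ha : a ≠ 0) (hb : b ≠ 0) (hd : d ≠ 0) (he : e ≠ 0)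
    (hqj : ∀ j : ℕ, 1 ≤ j → j ≤ n → q ^ j ≠ 1)
    (hdj : ∀ j : ℕ, j < n → d ≠ (q ^ j)⁻¹)
    (hej : ∀ j : ℕ, j < n → e ≠ (q ^ j)⁻¹)
    (hea : ∀ j : ℕ, j < n → e ≠ a * q ^ ((1 : ℤ) - (n : ℤ) + (j : ℤ))) :
    (∑ k ∈ Finset.range (n + 1),
        (qPochC (q ^ n) q⁻¹ k * qPochC a⁻¹ q⁻¹ k * qPochC b⁻¹ q⁻¹ k) /
          (qPochC q⁻¹ q⁻¹ k * qPochC d⁻¹ q⁻¹ k * qPochC e⁻¹ q⁻¹ k) * q⁻¹ ^ k)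
      = (qPochC (e / a) q n / qPochC e q n) *
        ∑ k ∈ Finset.range (n + 1),
          (qPochC (q ^ (-(n : ℤ))) q k * qPochC a q k * qPochC (d / b) q k) /
            (qPochC q q k * qPochC d q k * qPochC (a * q ^ ((1 : ℤ) - (n : ℤ)) / e) q k) *
            q ^ k := by
  have hE : ∀ i < n, e * q ^ i ≠ 1 := fun i hi h1 => hej i hi (eq_inv_of_mul_eq_one_left h1)
  have hD : ∀ i < n, d * q ^ i ≠ 1 := fun i hi h1 => hdj i hi (eq_inv_of_mul_eq_one_left h1)
  have hz : q ^ ((1 : ℤ) - (n : ℤ)) = q / q ^ n := by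
    rw [zpow_sub₀ hq, zpow_one, zpow_natCast]
  have hc : a * q ^ ((1 : ℤ) - (n : ℤ)) / e = a * q / q ^ n / e := by rw [hz, mul_div_assoc a q]
  have hc0 : ∀ j ≤ n, qPochC (a * q / q ^ n / e) q j ≠ 0 := fun j hj =>
    qPochC_ne_zero fun i hi h1 => hea i (by omega) (by
      rw [zpow_add₀ hq, zpow_natCast, hz]
      field_simp at h1 ⊢
      exact h1.symm)
  have hL : ∀ k ∈ range (n + 1),
      (qPochC (q ^ n) q⁻¹ k * qPochC a⁻¹ q⁻¹ k * qPochC b⁻¹ q⁻¹ k) /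
        (qPochC q⁻¹ q⁻¹ k * qPochC d⁻¹ q⁻¹ k * qPochC e⁻¹ q⁻¹ k) * q⁻¹ ^ k =
      ∑ j ∈ range (k + 1), qWeight q n (j + (k - j)) *
        (qPochC a q (j + (k - j)) / qPochC e q (j + (k - j)) *
          (e * q ^ n / (a * q)) ^ (j + (k - j))) *
        qWeight q (j + (k - j)) j * (qPochC (d / b) q j / qPochC d q j) := by
    intro k hk
    have hk := Nat.lt_succ_iff.1 (mem_range.1 hk)
    have hCV := sum_qWeight_mul_div hq (div_ne_zero hd hb) k
      (fun i hi hik => hqj i hi (by omega)) d (fun i hi => hD i (by omega))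
    rw [div_div_cancel₀ hd] at hCV
    have e0 : ∀ j ∈ range (k + 1), qWeight q n (j + (k - j)) *
        (qPochC a q (j + (k - j)) / qPochC e q (j + (k - j)) *
          (e * q ^ n / (a * q)) ^ (j + (k - j))) *
        qWeight q (j + (k - j)) j * (qPochC (d / b) q j / qPochC d q j) =
        qWeight q n k * (qPochC a q k / qPochC e q k * (e * q ^ n / (a * q)) ^ k) *
          (qWeight q k j * (qPochC (d / b) q j / qPochC d q j)) := by
      intro j hj
      rw [Nat.add_sub_cancel' (Nat.lt_succ_iff.1 (mem_range.1 hj)), mul_assoc]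
    rw [sum_congr rfl e0, ← mul_sum, hCV]
    have e1 : qPochC q q k ≠ 0 := qPochC_self_ne_zero fun i hi hij => hqj i hi (by omega)
    have e2 : qPochC d q k ≠ 0 := qPochC_ne_zero fun i hi => hD i (by omega)
    have e3 : qPochC e q k ≠ 0 := qPochC_ne_zero fun i hi => hE i (by omega)
    have e4 := qPochC_inv (inv_ne_zero (pow_ne_zero n hq)) hq k
    rw [inv_inv] at e4
    have e5 : ∏ j ∈ range k, (-(q ^ j)⁻¹) ≠ 0 :=
      prod_ne_zero_iff.2 fun i _ => neg_ne_zero.2 (inv_ne_zero (pow_ne_zero i hq))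
    rw [e4, qPochC_inv ha hq, qPochC_inv hb hq, qPochC_inv hq hq, qPochC_inv hd hq,
      qPochC_inv he hq, qWeight]
    generalize ∏ j ∈ range k, (-(q ^ j)⁻¹) = r at e5
    simp only [inv_pow, div_pow, mul_pow]
    field_simp
  rw [sum_congr rfl hL, sum_range_diag_flip (n + 1) (fun j m => qWeight q n (j + m) *
    (qPochC a q (j + m) / qPochC e q (j + m) * (e * q ^ n / (a * q)) ^ (j + m)) *
      qWeight q (j + m) j * (qPochC (d / b) q j / qPochC d q j)), mul_sum]
  refine sum_congr rfl fun j hj => ?_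
  obtain ⟨N, rfl⟩ := Nat.exists_eq_add_of_le (Nat.lt_succ_iff.1 (mem_range.1 hj))
  rw [← sum_mul, show j + N + 1 - j = N + 1 by omega,
    sum_qWeight_mul_qWeight hq ha he j N hqj hE (hc0 j (by omega)), hc, zpow_neg, zpow_natCast,
    qWeight]
  ring
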